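/- For every state-feedback policy μ : X → U and every initial state x₀ ∈ X, the liminf average cost of the multiple-requests problem satisfies J_(μ, x₀) ≥ min_{m ∈ S^k} G(m). -/

import Mathlib

open Filter Finset

/-- Distribution of the chain after `t` steps under kernel `K`, started at `x₀`:
the `t`-fold monadic bind of `K` applied to the point mass at `x₀`. -/
noncomputable def chainDist {X : Type*} (K : X → PMF X) (x₀ : X) : ℕ → PMF X
  | 0 => PMF.pure x₀
  | t + 1 => (chainDist K x₀ t).bind K

/-- Expectation of `f` under a PMF on a finite type. -/
noncomputable def pmfExp {X : Type*} [Fintype X] (q : PMF X) (f : X → ℝ) : ℝ :=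
  ∑ x, (q x).toReal * f x

/-- The average cost over periods `0,…,T` of running the Markov chain with step
kernel `K` and per-stage cost `c`, started at `x₀`. -/
noncomputable def avgCost {X : Type*} [Fintype X] (K : X → PMF X) (c : X → ℝ)
    (x₀ : X) (T : ℕ) : ℝ :=
  (1 / (T + 1 : ℝ)) * ∑ t ∈ Finset.range (T + 1), pmfExp (chainDist K x₀ t) c

/-- Injective assignments of the `n` requests to `n` distinct servers among `k`. -/
def Assign (n k : ℕ) : Type := {u : Fin n → Fin k // Function.Injective u}

instance (n k : ℕ) : Fintype (Assign n k) := Subtype.fintype _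

/-- The post-decision server positions: server `u_j` relocates to request `x̂_j`
for each `j`, other servers are unchanged. -/
noncomputable def moveServers {S : Type*} {n k : ℕ} (xh : Fin n → S) (xs : Fin k → S)
    (u : Assign n k) : Fin k → S :=
  fun i => if h : ∃ j, u.1 j = i then xh h.choose else xs i

/-- Step kernel of the stochastic `k`-server problem with `n` requests per period
under policy `μ`: the servers chosen by `μ x` relocate to the respective requests
and the next request tuple is drawn from `p`. -/
noncomputable def multiKernel {S : Type*} {n k : ℕ} (p : PMF (Fin n → S))
    (μ : (Fin n → S) × (Fin k → S) → Assign n k)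
    (x : (Fin n → S) × (Fin k → S)) : PMF ((Fin n → S) × (Fin k → S)) :=
  p.map (fun s => (s, moveServers x.1 x.2 (μ x)))

/-- Per-stage cost with `n` requests per period:
`r(x, u) = Σ_j d(x_{u_j}, x̂_j)` evaluated at `u = μ x`. -/
noncomputable def multiCost {S : Type*} [MetricSpace S] {n k : ℕ}
    (μ : (Fin n → S) × (Fin k → S) → Assign n k)
    (x : (Fin n → S) × (Fin k → S)) : ℝ :=
  ∑ j, dist (x.2 ((μ x).1 j)) (x.1 j)

/-- The generalized `k`-median objective for `n` requests per period:
`G(m) = Σ_{s ∈ Sⁿ} p(s) · min_{u} Σ_j d(m_{u_j}, s_j)`. -/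
noncomputable def multiMedian {S : Type*} [Fintype S] [MetricSpace S] {n k : ℕ}
    (hnk : n ≤ k) (p : PMF (Fin n → S)) (m : Fin k → S) : ℝ :=
  ∑ s, (p s).toReal *
    Finset.univ.inf'
      (Finset.univ_nonempty_iff.mpr ⟨⟨Fin.castLE hnk, Fin.castLE_injective hnk⟩⟩)
      (fun u : Assign n k => ∑ j, dist (m (u.1 j)) (s j))

theorem sum_toReal_pmf {X : Type*} [Fintype X] (q : PMF X) : ∑ x, (q x).toReal = 1 := by
  rw [← ENNReal.toReal_sum fun x _ => q.apply_ne_top x, ← tsum_fintype (L := .unconditional X),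
    q.tsum_coe, ENNReal.toReal_one]

theorem pmfExp_pure {X : Type*} [Fintype X] (x : X) (f : X → ℝ) :
    pmfExp (PMF.pure x) f = f x := by
  classical
  simp [pmfExp, PMF.pure_apply, apply_ite ENNReal.toReal]

theorem pmfExp_bind {X Y : Type*} [Fintype X] [Fintype Y] (q : PMF X) (K : X → PMF Y)
    (f : Y → ℝ) : pmfExp (q.bind K) f = pmfExp q fun x => pmfExp (K x) f := by
  have h (y : Y) : (q.bind K y).toReal = ∑ x, (q x).toReal * (K x y).toReal := by
    rw [PMF.bind_apply, tsum_fintype, ENNReal.toReal_sum fun x _ =>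
      ENNReal.mul_ne_top (q.apply_ne_top x) ((K x).apply_ne_top y)]
    simp only [ENNReal.toReal_mul]
  simp only [pmfExp, h, Finset.sum_mul, Finset.mul_sum]
  rw [Finset.sum_comm]
  simp only [mul_assoc]

theorem pmfExp_map {X Y : Type*} [Fintype X] [Fintype Y] (q : PMF X) (g : X → Y)
    (f : Y → ℝ) : pmfExp (q.map g) f = pmfExp q (f ∘ g) := by
  rw [← PMF.bind_pure_comp, pmfExp_bind]
  simp only [Function.comp_apply, pmfExp_pure]
  rfl

theorem pmfExp_const {X : Type*} [Fintype X] (q : PMF X) (a : ℝ) :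
    (pmfExp q fun _ => a) = a := by
  rw [pmfExp, ← Finset.sum_mul, sum_toReal_pmf, one_mul]

theorem pmfExp_mono {X : Type*} [Fintype X] (q : PMF X) {f g : X → ℝ} (h : ∀ x, f x ≤ g x) :
    pmfExp q f ≤ pmfExp q g :=
  Finset.sum_le_sum fun x _ => mul_le_mul_of_nonneg_left (h x) ENNReal.toReal_nonneg

theorem le_pmfExp {X : Type*} [Fintype X] (q : PMF X) {f : X → ℝ} {a : ℝ} (h : ∀ x, a ≤ f x) :
    a ≤ pmfExp q f :=
  (pmfExp_const q a).symm.trans_le (pmfExp_mono q h)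

theorem pmfExp_le {X : Type*} [Fintype X] (q : PMF X) {f : X → ℝ} {a : ℝ} (h : ∀ x, f x ≤ a) :
    pmfExp q f ≤ a :=
  (pmfExp_mono q h).trans_eq (pmfExp_const q a)

/-- If the one-step expected cost is at least `a` from every state, then so is the liminf
average cost. -/
theorem le_liminf_avgCost {X : Type*} [Fintype X] (K : X → PMF X) (c : X → ℝ) (x₀ : X) {a : ℝ}
    (hc : ∀ x, 0 ≤ c x) (ha : ∀ x, a ≤ pmfExp (K x) c) :
    a ≤ liminf (avgCost K c x₀) atTop := by
  have hlim : Tendsto (fun T : ℕ => (T / (T + 1) : ℝ) * a) atTop (nhds a) := by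
    simpa using (tendsto_natCast_div_add_atTop (1 : ℝ)).mul_const a
  have hlow (T : ℕ) : (T / (T + 1) : ℝ) * a ≤ avgCost K c x₀ T := by
    have hstep : ∑ _t ∈ Finset.range T, a ≤
        ∑ t ∈ Finset.range T, pmfExp (chainDist K x₀ (t + 1)) c :=
      Finset.sum_le_sum fun t _ => by
        rw [chainDist, pmfExp_bind]
        exact le_pmfExp _ ha
    have hzero : 0 ≤ pmfExp (chainDist K x₀ 0) c := le_pmfExp _ hc
    rw [Finset.sum_const, Finset.card_range, nsmul_eq_mul] at hstep
    rw [avgCost, Finset.sum_range_succ', div_eq_mul_one_div, mul_comm (T : ℝ), mul_assoc]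
    gcongr
    linarith
  have hup (T : ℕ) : avgCost K c x₀ T ≤ ∑ x, c x := by
    have h : ∑ t ∈ Finset.range (T + 1), pmfExp (chainDist K x₀ t) c ≤
        ∑ _t ∈ Finset.range (T + 1), ∑ x, c x :=
      Finset.sum_le_sum fun t _ => pmfExp_le _ fun x =>
        Finset.single_le_sum (fun y _ => hc y) (Finset.mem_univ x)
    rw [Finset.sum_const, Finset.card_range, nsmul_eq_mul] at h
    push_cast at h
    rw [avgCost, one_div, inv_mul_le_iff₀ (by positivity)]
    exact h
  calc a = liminf (fun T : ℕ => (T / (T + 1) : ℝ) * a) atTop := hlim.liminf_eq.symm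
    _ ≤ liminf (avgCost K c x₀) atTop :=
      liminf_le_liminf (Eventually.of_forall hlow) hlim.isBoundedUnder_ge
        (isBoundedUnder_of ⟨_, hup⟩).isCoboundedUnder_ge

/-- Whatever the state, the expected cost of the next period is at least the median objective
at the post-decision server positions. -/
theorem multiMedian_le_pmfExp_multiKernel {S : Type*} [Fintype S] [MetricSpace S] {n k : ℕ}
    (hnk : n ≤ k) (p : PMF (Fin n → S)) (μ : (Fin n → S) × (Fin k → S) → Assign n k)
    (x : (Fin n → S) × (Fin k → S)) :
    multiMedian hnk p (moveServers x.1 x.2 (μ x)) ≤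
      pmfExp (multiKernel p μ x) (multiCost μ) := by
  rw [multiKernel, pmfExp_map]
  exact pmfExp_mono p fun s => Finset.inf'_le _ (Finset.mem_univ (μ (s, _)))

/-- For the stochastic `k`-server problem with `n` requests per period, the liminf
average cost of any policy is bounded below by the optimal value of the generalized
`k`-median problem. -/
theorem multi_liminf_avg_cost_ge_multiMedian_min
    {S : Type*} [Fintype S] [Nonempty S] [MetricSpace S] {n k : ℕ}
    (hn : 0 < n) (hnk : n ≤ k) (p : PMF (Fin n → S))
    (μ : (Fin n → S) × (Fin k → S) → Assign n k)
    (x₀ : (Fin n → S) × (Fin k → S)) :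
    liminf (avgCost (multiKernel p μ) (multiCost μ) x₀) atTop ≥
      Finset.univ.inf' Finset.univ_nonempty
        (fun m : Fin k → S => multiMedian hnk p m) := by
  exact le_liminf_avgCost _ _ _ (fun x => Finset.sum_nonneg fun j _ => dist_nonneg) fun x =>
    (Finset.inf'_le _ (Finset.mem_univ _)).trans (multiMedian_le_pmfExp_multiKernel hnk p μ x)
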